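/- The four conditions Eval(C), MP(C), Cons(C), and Dec(C) are jointly inconsistent: their conjunction implies False. -/

import Mathlib

inductive Form : Type
  | Bot : Form
  | Imp : Form → Form → Form

def FNeg (A : Form) : Form := Form.Imp A Form.Bot

def Eqv (C : Form → Prop) (A B : Form) : Prop :=
  C (Form.Imp A B) ∧ C (Form.Imp B A)

def MP (C : Form → Prop) : Prop :=
  ∀ A B, C (Form.Imp A B) → C A → C B

def Cons (C : Form → Prop) : Prop := ¬ C Form.Bot

def LEM (C : Form → Prop) : Prop := ∀ A, C A ∨ C (FNeg A)

def EvalC {Code : Type} (eval : Code → Code → Form) (C : Form → Prop) : Prop :=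
  ∀ f : Code → Form, ∃ c : Code, ∀ x : Code, Eqv C (eval c x) (f x)

def Dec (C : Form → Prop) : Prop :=
  ∃ d : Form → Bool, (∀ A, d A = true → C A) ∧ (∀ A, d A = false → C (FNeg A))

theorem decision_obstruction {Code : Type} (eval : Code → Code → Form)
    (C : Form → Prop) (hEv : EvalC eval C) (hMP : MP C) (hCons : Cons C)
    (hDec : Dec C) : False := by 
  obtain ⟨d, hT, hF⟩ := hDec
  obtain ⟨c, hc⟩ := hEv (fun x => FNeg (eval x x))
  obtain ⟨h1, h2⟩ := hc c
  cases h : d (eval c c) with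
  | true =>
    have hA := hT _ h
    exact hCons (hMP _ _ (hMP _ _ h1 hA) hA)
  | false =>
    have hN := hF _ h
    exact hCons (hMP _ _ hN (hMP _ _ h2 hN))
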